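/- arXiv:0812.3848 — 3 statements merged into one kernel-verified Lean document; each statement's English description precedes it below -/
import Mathlib

section
/- Let m ≥ 1 and let k : ℤ² → Matrix (Fin m) (Fin m) ℂ be finitely supported and satisfy k(−v)ᵀ = −k(v) for all v ∈ ℤ². Define the symbol K̂(θ,φ) = ∑_{(x,y)∈ℤ²} k(x,y)·e^{i(xθ+yφ)}. Assume that K̂(θ,φ) is invertible for every (θ,φ) ∈ [0,2π)² with (θ,φ) ≠ (0,0), and that the function (θ,φ) ↦ ‖K̂(θ,φ)⁻¹‖ is integrable on [0,2π]². Then for every rapidly decaying f : ℤ² → ℂ^m there exists a unique u : ℤ² → ℂ^m vanishing at infinity such that for all v ∈ ℤ², ∑_{v'∈ℤ²} k(v−v')·u(v') = f(v). -/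
open Filter MeasureTheory Real

attribute [local instance] Matrix.normedAddCommGroup

section GelfandHille

/-- Exponential type zero and bounded on the real line: bounded on the upper half plane. -/
lemma pl_half {E : Type*} [NormedAddCommGroup E] [NormedSpace ℂ E] (F : ℂ → E)
    (hd : Differentiable ℂ F)
    (hg : ∀ δ : ℝ, 0 < δ → ∃ C : ℝ, ∀ z, ‖F z‖ ≤ C * Real.exp (δ * ‖z‖))
    (B : ℝ) (hB : ∀ x : ℝ, ‖F x‖ ≤ B) (w : ℂ) (hw : 0 ≤ w.re) : ‖F (Complex.I * w)‖ ≤ B := by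
  have key : ∀ ε : ℝ, 0 < ε → ‖F (Complex.I * w)‖ * Real.exp (-ε * w.re) ≤ B := by
    intro ε hε
    have hn : ∀ z : ℂ, ‖Complex.exp (-ε * z) • F (Complex.I * z)‖
        = ‖F (Complex.I * z)‖ * Real.exp (-ε * z.re) := by
      intro z
      rw [norm_smul, Complex.norm_exp, mul_comm]
      simp
    rw [← hn w]
    refine PhragmenLindelof.right_half_plane_of_tendsto_zero_on_real
      (f := fun z => Complex.exp (-ε * z) • F (Complex.I * z)) (C := B) ?_ ?_ ?_ ?_ hw
    · apply Differentiable.diffContOnCl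
      apply Differentiable.smul
      · fun_prop
      · exact hd.comp (by fun_prop)
    · refine ⟨1, by norm_num, 1, ?_⟩
      obtain ⟨C, hC⟩ := hg 1 one_pos
      refine Asymptotics.IsBigO.of_bound C ?_
      rw [eventually_inf_principal]
      refine Eventually.of_forall fun z hz => ?_
      have hz' : 0 < z.re := hz
      rw [hn z]
      have h1 := hC (Complex.I * z)
      rw [norm_mul, Complex.norm_I, one_mul] at h1
      have h2 : Real.exp (-ε * z.re) ≤ 1 := by
        rw [Real.exp_le_one_iff]; nlinarith
      rw [Real.norm_of_nonneg (Real.exp_pos _).le, Real.rpow_one]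
      calc _ ≤ ‖F (Complex.I * z)‖ * 1 := by gcongr
        _ ≤ _ := by rw [mul_one]; exact h1
    · obtain ⟨C, hC⟩ := hg (ε/2) (by positivity)
      rw [tendsto_zero_iff_norm_tendsto_zero]
      have ht : Tendsto (fun x : ℝ => C * Real.exp (-(ε/2) * x)) atTop (nhds 0) := by
        rw [← mul_zero C]
        refine Tendsto.const_mul _ ?_
        refine Real.tendsto_exp_atBot.comp ?_
        exact tendsto_id.const_mul_atTop_of_neg (by linarith)
      refine squeeze_zero' (Eventually.of_forall fun _ => norm_nonneg _) ?_ ht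
      filter_upwards [eventually_ge_atTop 0] with x hx
      rw [hn x]
      have h1 := hC (Complex.I * x)
      rw [norm_mul, Complex.norm_I, one_mul, Complex.norm_real, Real.norm_of_nonneg hx] at h1
      calc _ ≤ (C * Real.exp (ε/2 * x)) * Real.exp (-ε * x) := by
            rw [Complex.ofReal_re]; gcongr
        _ = _ := by rw [mul_assoc, ← Real.exp_add]; ring_nf
    · intro x
      rw [hn]
      have := hB (-x)
      have h2 : Complex.I * (x * Complex.I) = ((-x : ℝ) : ℂ) := by
        push_cast; linear_combination (x:ℂ) * Complex.I_mul_I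
      rw [h2]; simpa using this
  have ht : Tendsto (fun ε : ℝ => ‖F (Complex.I * w)‖ * Real.exp (-ε * w.re)) (nhdsWithin 0 (Set.Ioi 0))
      (nhds (‖F (Complex.I * w)‖)) := by
    have : Continuous (fun ε : ℝ => ‖F (Complex.I * w)‖ * Real.exp (-ε * w.re)) := by fun_prop
    have h := (this.tendsto 0).mono_left (nhdsWithin_le_nhds (s := Set.Ioi 0))
    simpa using h
  refine le_of_tendsto ht ?_
  filter_upwards [self_mem_nhdsWithin] with ε hε using key ε hε

lemma entire_const {E : Type*} [NormedAddCommGroup E] [NormedSpace ℂ E] (F : ℂ → E)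
    (hd : Differentiable ℂ F)
    (hg : ∀ δ : ℝ, 0 < δ → ∃ C : ℝ, ∀ z, ‖F z‖ ≤ C * Real.exp (δ * ‖z‖))
    (B : ℝ) (hB : ∀ x : ℝ, ‖F x‖ ≤ B) (z w : ℂ) : F z = F w := by
  refine hd.apply_eq_apply_of_bounded ?_ z w
  rw [isBounded_iff_forall_norm_le]
  refine ⟨B, ?_⟩
  rintro _ ⟨z, rfl⟩
  rcases le_total 0 z.im with h | h
  · have := pl_half F hd hg B hB (-Complex.I * z) (by simpa using h)
    rwa [show Complex.I * (-Complex.I * z) = z by linear_combination (-z) * Complex.I_mul_I] at this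
  · have := pl_half (fun z => F (-z)) (hd.comp (by fun_prop)) (fun δ hδ => by
      obtain ⟨C, hC⟩ := hg δ hδ
      exact ⟨C, fun z => by simpa using hC (-z)⟩) B (fun x => by simpa using hB (-x))
      (Complex.I * z) (by simpa using h)
    rwa [show -(Complex.I * (Complex.I * z)) = z by linear_combination (-z) * Complex.I_mul_I] at this

/-- generalized binomial coefficients -/
noncomputable def bin : ℕ → ℂ → ℂ
  | 0, _ => 1
  | n+1, z => bin n z * (z - n) / (n+1)

lemma bin_pascal (n : ℕ) (z : ℂ) : bin (n+1) (z+1) = bin (n+1) z + bin n z := by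
  induction n with
  | zero => simp [bin]
  | succ n ih =>
    have h1 : ((n:ℂ)+1) ≠ 0 := by exact_mod_cast Nat.succ_ne_zero n
    have h2 : ((n:ℂ)+1+1) ≠ 0 := by exact_mod_cast Nat.succ_ne_zero (n+1)
    have e1 : bin (n+1+1) (z+1) = bin (n+1) (z+1) * ((z+1) - (n+1 : ℕ)) / ((n+1 : ℕ) + 1) := rfl
    have e2 : bin (n+1+1) z = bin (n+1) z * (z - (n+1 : ℕ)) / ((n+1 : ℕ) + 1) := rfl
    have e3 : bin (n+1) z = bin n z * (z - n) / (n + 1) := rfl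
    rw [e1, e2, ih, e3]
    push_cast
    field_simp
    ring

lemma bin_zero (n : ℕ) : bin (n+1) 0 = 0 := by
  induction n with
  | zero => simp [bin]
  | succ n ih => rw [bin, ih]; simp

lemma bin_diff (n : ℕ) : Differentiable ℂ (bin n) := by
  induction n with
  | zero => exact differentiable_const _
  | succ n ih =>
    change Differentiable ℂ (fun z => bin n z * (z - n) / (n+1))
    fun_prop

lemma bin_bound0 (n N : ℕ) (h : n ≤ N) (z : ℂ) : ‖bin n z‖ ≤ (‖z‖ + N)^n / n.factorial := by
  induction n with
  | zero => simp [bin]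
  | succ n ih =>
    have ih := ih (by omega)
    rw [bin, norm_div, norm_mul]
    have h1 : ‖(n:ℂ)+1‖ = n + 1 := by
      rw [← Nat.cast_add_one, Complex.norm_natCast]; simp
    have h2 : ‖z - n‖ ≤ ‖z‖ + N := by
      refine (norm_sub_le _ _).trans ?_
      rw [Complex.norm_natCast]
      have : (n:ℝ) ≤ N := by exact_mod_cast (by omega : n ≤ N)
      linarith
    rw [h1, Nat.factorial_succ, pow_succ, Nat.cast_mul, div_le_div_iff₀ (by positivity) (by positivity)]
    rw [le_div_iff₀ (by positivity)] at ih
    push_cast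
    calc _ = (‖bin n z‖ * n.factorial) * ‖z - n‖ * (n+1) := by ring
      _ ≤ (‖z‖ + N)^n * (‖z‖ + N) * (n+1) := by gcongr

lemma bin_bound (n : ℕ) (z : ℂ) (δ : ℝ) (hδ : 0 < δ) :
    ‖bin n z‖ ≤ Real.exp (δ * ‖z‖) * (Real.exp δ / δ)^n := by
  refine (bin_bound0 n n le_rfl z).trans ?_
  have h := Real.pow_div_factorial_le_exp (x := δ * (‖z‖ + n)) (by positivity) n
  rw [mul_add, Real.exp_add, mul_comm δ (n:ℝ), Real.exp_nat_mul, mul_comm (n:ℝ) δ, ← mul_add, mul_pow] at h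
  rw [div_pow, ← mul_div_assoc, le_div_iff₀ (by positivity)]
  calc _ = δ ^ n * (‖z‖ + n)^n / n.factorial := by ring
    _ ≤ _ := h

theorem gelfand_hille {A : Type*} [NormedRing A] [NormedAlgebra ℂ A] [CompleteSpace A] (N S : A)
    (hq : ∀ ε : ℝ, 0 < ε → ∃ C : ℝ, ∀ n : ℕ, ‖N^n‖ ≤ C * ε^n)
    (M : ℝ) (h1 : ∀ n : ℕ, ‖(1+N)^n‖ ≤ M) (h2 : ∀ n : ℕ, ‖S^n‖ ≤ M)
    (hS : S * (1+N) = 1) : N = 0 := by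
  set F : ℂ → A := fun z => ∑' n, bin n z • N^n with hF
  have hterm : ∀ δ : ℝ, 0 < δ → ∃ C : ℝ, 0 ≤ C ∧ ∀ n z, ‖bin n z • N^n‖ ≤ C * Real.exp (δ * ‖z‖) * (1/2)^n := by
    intro δ hδ
    obtain ⟨C, hC⟩ := hq (δ / Real.exp δ / 2) (by positivity)
    have hC0 : 0 ≤ C := by
      have := (norm_nonneg _).trans (hC 0); simpa using this
    refine ⟨C, hC0, fun n z => ?_⟩
    rw [norm_smul]
    calc _ ≤ (Real.exp (δ * ‖z‖) * (Real.exp δ / δ)^n) * (C * (δ / Real.exp δ / 2)^n) := by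
          gcongr
          · exact bin_bound n z δ hδ
          · exact hC n
      _ = C * Real.exp (δ * ‖z‖) * ((Real.exp δ / δ) * (δ / Real.exp δ / 2))^n := by
          rw [mul_pow]; ring
      _ = _ := by
          congr 2
          have := (Real.exp_pos δ).ne'
          field_simp
  have hgeo : Summable (fun n : ℕ => (1/2 : ℝ)^n) := summable_geometric_two
  have hsum : ∀ z, Summable (fun n => bin n z • N^n) := by
    intro z
    obtain ⟨C, hC0, hC⟩ := hterm 1 one_pos
    exact Summable.of_norm_bounded (hgeo.mul_left _) (fun n => hC n z)
  have hg : ∀ δ : ℝ, 0 < δ → ∃ C : ℝ, ∀ z, ‖F z‖ ≤ C * Real.exp (δ * ‖z‖) := by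
    intro δ hδ
    obtain ⟨C, hC0, hC⟩ := hterm δ hδ
    refine ⟨C * 2, fun z => ?_⟩
    have := tsum_of_norm_bounded ((hasSum_geometric_two).mul_left (C * Real.exp (δ * ‖z‖))) (fun n => hC n z)
    refine this.trans (le_of_eq (by ring))
  have hd : Differentiable ℂ F := by
    intro z
    obtain ⟨C, hC0, hC⟩ := hterm 1 one_pos
    have : DifferentiableOn ℂ F (Metric.ball 0 (‖z‖ + 1)) := by
      refine Complex.differentiableOn_tsum_of_summable_norm
        (hgeo.mul_left (C * Real.exp (1 * (‖z‖+1)))) (fun n => ?_) Metric.isOpen_ball (fun n w hw => ?_)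
      · exact ((bin_diff n).smul_const _).differentiableOn
      · refine (hC n w).trans ?_
        have : ‖w‖ ≤ ‖z‖ + 1 := by simpa using (mem_ball_zero_iff.1 hw).le
        gcongr
    exact this.differentiableAt (Metric.isOpen_ball.mem_nhds (by simp))
  have hF0 : F 0 = 1 := by
    rw [hF]; dsimp only
    rw [tsum_eq_single 0]
    · simp [bin]
    · intro n hn
      obtain ⟨k, rfl⟩ := Nat.exists_eq_succ_of_ne_zero hn
      rw [bin_zero, zero_smul]
  have hstep : ∀ z, F (z+1) = (1+N) * F z := by
    intro z
    have e1 : F (z+1) = bin 0 (z+1) • N^0 + ∑' n, bin (n+1) (z+1) • N^(n+1) := (hsum (z+1)).tsum_eq_zero_add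
    have e2 : F z = bin 0 z • N^0 + ∑' n, bin (n+1) z • N^(n+1) := (hsum z).tsum_eq_zero_add
    have e3 : N * F z = ∑' n, bin n z • N^(n+1) := by
      rw [hF]; dsimp only
      rw [← (hsum z).tsum_mul_left]
      congr 1; ext n; rw [mul_smul_comm, pow_succ']
    have s1 : Summable (fun n => bin n z • N^(n+1)) := by
      have := (hsum z).mul_left N
      refine this.congr fun n => ?_
      rw [mul_smul_comm, pow_succ']
    rw [add_mul, one_mul, e3, e1, e2]
    simp only [bin_pascal, add_smul]
    rw [Summable.tsum_add ((summable_nat_add_iff 1).2 (hsum z)) s1]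
    simp only [bin]
    abel
  have hstepn : ∀ (n : ℕ) z, F (z+n) = (1+N)^n * F z := by
    intro n z
    induction n with
    | zero => simp
    | succ n ih => rw [Nat.cast_succ, ← add_assoc, hstep, ih, pow_succ', mul_assoc]
  have hSn : ∀ n : ℕ, S^n * (1+N)^n = 1 := by
    intro n
    induction n with
    | zero => simp
    | succ n ih => rw [pow_succ S, pow_succ' (1+N), mul_assoc, ← mul_assoc S, hS, one_mul, ih]
  have hstepm : ∀ (n : ℕ) z, F (z-n) = S^n * F z := by
    intro n z
    have := hstepn n (z-n)
    rw [sub_add_cancel] at this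
    rw [this, ← mul_assoc, hSn, one_mul]
  obtain ⟨C, hC⟩ := hg 1 one_pos
  have hC0 : 0 ≤ C := by have := (norm_nonneg _).trans (hC 0); simpa using this
  have hM0 : 0 ≤ M := (norm_nonneg _).trans (h1 0)
  have hB : ∀ x : ℝ, ‖F x‖ ≤ M * (C * Real.exp 1) := by
    intro x
    have hf : ‖F (Int.fract x : ℝ)‖ ≤ C * Real.exp 1 := by
      refine (hC _).trans ?_
      have : ‖((Int.fract x : ℝ) : ℂ)‖ ≤ 1 := by
        rw [Complex.norm_real, Real.norm_of_nonneg (Int.fract_nonneg x)]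
        exact (Int.fract_lt_one x).le
      gcongr
      linarith
    have hx : (x : ℂ) = (Int.fract x : ℝ) + ((⌊x⌋ : ℤ) : ℂ) := by
      rw [← Complex.ofReal_intCast, ← Complex.ofReal_add, Int.fract_add_floor]
    rcases Int.eq_nat_or_neg ⌊x⌋ with ⟨n, h | h⟩
    · rw [hx, h, Int.cast_natCast, hstepn]
      refine (norm_mul_le _ _).trans ?_
      gcongr
      exact h1 n
    · rw [hx, h, Int.cast_neg, Int.cast_natCast, ← sub_eq_add_neg, hstepm]
      refine (norm_mul_le _ _).trans ?_
      gcongr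
      exact h2 n
  have hc := entire_const F hd hg _ hB 1 0
  have h01 := hstep 0
  rw [zero_add, hc, hF0, mul_one] at h01
  have := h01.symm
  simpa using this

end GelfandHille
section Laurent

lemma quasinilp {A : Type*} [NormedCommRing A] [NormedAlgebra ℂ A] [CompleteSpace A] (N : A)
    (h : ∀ χ : A →ₐ[ℂ] ℂ, χ N = 0) (ε : ℝ) (hε : 0 < ε) : ∃ C : ℝ, ∀ n : ℕ, ‖N^n‖ ≤ C * ε^n := by
  have hr : spectralRadius ℂ N = 0 := by
    rw [spectralRadius]
    refine le_antisymm (iSup₂_le fun z hz => ?_) bot_le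
    rw [WeakDual.CharacterSpace.mem_spectrum_iff_exists] at hz
    obtain ⟨f, hf⟩ := hz
    have := h (WeakDual.CharacterSpace.equivAlgHom f)
    rw [WeakDual.CharacterSpace.equivAlgHom_coe, hf] at this
    simp [this]
  have ht := spectrum.pow_norm_pow_one_div_tendsto_nhds_spectralRadius N
  rw [hr] at ht
  have hev := ht.eventually (gt_mem_nhds (show (0:ENNReal) < ENNReal.ofReal ε by simpa using hε))
  obtain ⟨n0, hn0⟩ := eventually_atTop.1 (hev.and (eventually_ge_atTop 1))
  have hbig : ∀ n ≥ n0, ‖N^n‖ ≤ ε^n := by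
    intro n hn
    obtain ⟨h1, h2⟩ := hn0 n hn
    rw [ENNReal.ofReal_lt_ofReal_iff hε] at h1
    have h3 : (‖N^n‖ ^ (1 / n : ℝ))^n ≤ ε^n := by gcongr
    rwa [one_div, Real.rpow_inv_natCast_pow (norm_nonneg _) (by omega)] at h3
  refine ⟨1 + ∑ n ∈ Finset.range n0, ‖N^n‖ / ε^n, fun n => ?_⟩
  have hpos : 0 < ε^n := by positivity
  rw [← div_le_iff₀ hpos]
  by_cases hn : n < n0
  · have := Finset.single_le_sum (f := fun n => ‖N^n‖ / ε^n) (fun i _ => by positivity) (Finset.mem_range.2 hn)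
    linarith
  · have h1 := hbig n (not_lt.1 hn)
    have h2 : ‖N^n‖ / ε^n ≤ 1 := by rwa [div_le_one hpos]
    have h3 : 0 ≤ ∑ n ∈ Finset.range n0, ‖N^n‖ / ε^n := Finset.sum_nonneg fun i _ => by positivity
    linarith

abbrev Lau := AddMonoidAlgebra ℂ (ℤ × ℤ)

noncomputable abbrev mon (v : ℤ × ℤ) : Lau := AddMonoidAlgebra.single v 1

lemma mon_add (v w : ℤ × ℤ) : mon (v + w) = mon v * mon w := by
  simp [mon, AddMonoidAlgebra.single_mul_single]

lemma mon_zero : mon 0 = 1 := rfl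

lemma mon_nsmul (n : ℕ) (v : ℤ × ℤ) : mon (n • v) = mon v ^ n := by
  simp [mon, AddMonoidAlgebra.single_pow]

theorem laurent_comm {A : Type*} [NormedCommRing A] [NormedAlgebra ℂ A] [CompleteSpace A]
    (ρ : Lau →ₐ[ℂ] A) (hρ : ∀ v, ‖ρ (mon v)‖ ≤ 1) (d : Lau) (hd0 : ρ d = 0)
    (hd : ∀ χ : Lau →ₐ[ℂ] ℂ, (∀ v, ‖χ (mon v)‖ = 1) → χ d = 0 → ∀ v, χ (mon v) = 1)
    (v : ℤ × ℤ) : ρ (mon v) = 1 := by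
  have h1 : ‖(1:A)‖ ≤ 1 := by have := hρ 0; rwa [mon_zero, map_one] at this
  have hN : ∀ χ : A →ₐ[ℂ] ℂ, χ (ρ (mon v) - 1) = 0 := by
    intro χ
    have hle : ∀ w, ‖χ (ρ (mon w))‖ ≤ 1 := by
      intro w
      refine (AlgHom.norm_apply_le_self_mul_norm_one χ _).trans ?_
      exact mul_le_one₀ (hρ w) (norm_nonneg _) h1
    have hn : ∀ w, ‖(χ.comp ρ) (mon w)‖ = 1 := by
      intro w
      refine le_antisymm (hle w) ?_
      have e : χ (ρ (mon w)) * χ (ρ (mon (-w))) = 1 := by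
        rw [← map_mul, ← map_mul, ← mon_add, add_neg_cancel, mon_zero, map_one, map_one]
      have e' := congrArg norm e
      rw [norm_mul, norm_one] at e'
      change 1 ≤ ‖χ (ρ (mon w))‖
      nlinarith [hle w, hle (-w), norm_nonneg (χ (ρ (mon w)))]
    have := hd (χ.comp ρ) hn (by simp [hd0]) v
    rw [map_sub, map_one, sub_eq_zero]; exact this
  have := gelfand_hille (ρ (mon v) - 1) (ρ (mon (-v))) (fun ε hε => quasinilp _ hN ε hε) 1
    (fun n => by rw [add_sub_cancel, ← map_pow, ← mon_nsmul]; exact hρ _)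
    (fun n => by rw [← map_pow, ← mon_nsmul]; exact hρ _)
    (by rw [add_sub_cancel, ← map_mul, ← mon_add, neg_add_cancel, mon_zero, map_one])
  exact sub_eq_zero.1 this

theorem laurent_gen {A : Type*} [NormedRing A] [NormedAlgebra ℂ A] [CompleteSpace A]
    (ρ : Lau →ₐ[ℂ] A) (hρ : ∀ v, ‖ρ (mon v)‖ ≤ 1) (d : Lau) (hd0 : ρ d = 0)
    (hd : ∀ χ : Lau →ₐ[ℂ] ℂ, (∀ v, ‖χ (mon v)‖ = 1) → χ d = 0 → ∀ v, χ (mon v) = 1)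
    (v : ℤ × ℤ) : ρ (mon v) = 1 := by
  let B : Subalgebra ℂ A := ρ.range.topologicalClosure
  let _ : CommRing B := ρ.range.commRingTopologicalClosure (by
    rintro ⟨_, x, rfl⟩ ⟨_, y, rfl⟩
    ext
    change ρ x * ρ y = ρ y * ρ x
    rw [← map_mul, mul_comm, map_mul])
  let _ : NormedCommRing B := { (inferInstance : NormedRing B) with mul_comm := mul_comm }
  let _ : NormedAlgebra ℂ B := { (inferInstance : Algebra ℂ B) with
    norm_smul_le := fun r x => norm_smul_le r (x : A) }
  have : CompleteSpace B := ρ.range.isClosed_topologicalClosure.completeSpace_coe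
  let ρ' : Lau →ₐ[ℂ] B := ρ.codRestrict B (fun x => ρ.range.le_topologicalClosure ⟨x, rfl⟩)
  have := laurent_comm ρ' (fun v => hρ v) d (Subtype.ext hd0) hd v
  exact congrArg Subtype.val this

end Laurent
section Action

/-- translation on functions -/
def shF : Multiplicative (ℤ × ℤ) →* Module.End ℂ (ℤ × ℤ → ℂ) where
  toFun v := { toFun := fun w x => w (x - v.toAdd), map_add' := fun _ _ => rfl, map_smul' := fun _ _ => rfl }
  map_one' := by ext w x; simp
  map_mul' a b := by ext w x; simp [sub_sub]

noncomputable def act : Lau →ₐ[ℂ] Module.End ℂ (ℤ × ℤ → ℂ) := AddMonoidAlgebra.lift ℂ _ _ shF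

lemma act_single (v : ℤ × ℤ) (c : ℂ) (w : ℤ × ℤ → ℂ) (x : ℤ × ℤ) :
    act (AddMonoidAlgebra.single v c) w x = c * w (x - v) := by
  simp [act, shF]

open BoundedContinuousFunction in
noncomputable def shB (v : ℤ × ℤ) : (ℤ × ℤ →ᵇ ℂ) →L[ℂ] (ℤ × ℤ →ᵇ ℂ) :=
  LinearMap.mkContinuous
    { toFun := fun w => w.compContinuous ⟨fun x => x - v, by fun_prop⟩
      map_add' := fun _ _ => rfl
      map_smul' := fun _ _ => rfl } 1 (fun w => by
        rw [one_mul, BoundedContinuousFunction.norm_le (norm_nonneg _)]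
        intro x
        exact w.norm_coe_le_norm _)

open BoundedContinuousFunction in
lemma shB_apply (v : ℤ × ℤ) (w : ℤ × ℤ →ᵇ ℂ) (x : ℤ × ℤ) : shB v w x = w (x - v) := rfl

open BoundedContinuousFunction in
lemma shB_norm (v : ℤ × ℤ) (w : ℤ × ℤ →ᵇ ℂ) : ‖shB v w‖ ≤ ‖w‖ := by
  rw [BoundedContinuousFunction.norm_le (norm_nonneg _)]
  intro x
  exact w.norm_coe_le_norm _

open BoundedContinuousFunction in
lemma act_cont (r : Lau) (x : ℤ × ℤ) : Continuous (fun w : ℤ × ℤ →ᵇ ℂ => act r (⇑w) x) := by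
  induction r using AddMonoidAlgebra.induction_linear with
  | zero => simpa using continuous_const
  | add f g hf hg => simp only [map_add, LinearMap.add_apply, Pi.add_apply]; exact hf.add hg
  | single v c =>
    simp only [act_single]
    exact continuous_const.mul (BoundedContinuousFunction.lipschitz_eval_const (x - v)).continuous

open BoundedContinuousFunction in
noncomputable def solX (d : Lau) : Submodule ℂ (ℤ × ℤ →ᵇ ℂ) where
  carrier := {w | act d (⇑w) = 0}
  add_mem' {a b} ha hb := by
    change act d (⇑a + ⇑b) = 0
    rw [map_add, ha, hb, add_zero]
  zero_mem' := map_zero (act d)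
  smul_mem' c a ha := by
    change act d (c • ⇑a) = 0
    rw [map_smul, ha, smul_zero]

open BoundedContinuousFunction in
lemma solX_closed (d : Lau) : IsClosed (solX d : Set (ℤ × ℤ →ᵇ ℂ)) := by
  have : (solX d : Set (ℤ × ℤ →ᵇ ℂ)) = ⋂ x, {w : ℤ × ℤ →ᵇ ℂ | act d (⇑w) x = 0} := by
    ext w
    rw [Set.mem_iInter]
    exact funext_iff
  rw [this]
  exact isClosed_iInter fun x => isClosed_eq (act_cont d x) continuous_const

lemma shB_mem (d : Lau) (v : ℤ × ℤ) (w : solX d) : shB v w.1 ∈ solX d := by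
  have h1 : (⇑(shB v w.1) : ℤ × ℤ → ℂ) = act (mon v) (⇑w.1) := by
    ext x; rw [act_single, one_mul]; rfl
  have h2 : act d (⇑w.1) = 0 := w.2
  change act d (⇑(shB v w.1)) = 0
  rw [h1, ← Module.End.mul_apply, ← map_mul, mul_comm, map_mul, Module.End.mul_apply, h2, map_zero]

noncomputable def shX (d : Lau) : Multiplicative (ℤ × ℤ) →* (solX d →L[ℂ] solX d) where
  toFun v := ((shB v.toAdd).comp (solX d).subtypeL).codRestrict (solX d) (fun w => shB_mem d _ w)
  map_one' := by
    ext w x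
    simp [shB_apply]
  map_mul' a b := by
    ext w x
    change w.1 (x - (a.toAdd + b.toAdd)) = w.1 (x - a.toAdd - b.toAdd)
    rw [sub_sub]

noncomputable def actX (d : Lau) : Lau →ₐ[ℂ] (solX d →L[ℂ] solX d) := AddMonoidAlgebra.lift ℂ _ _ (shX d)

lemma actX_coe (d r : Lau) (w : solX d) (x : ℤ × ℤ) : (actX d r w).1 x = act r (⇑w.1) x := by
  induction r using AddMonoidAlgebra.induction_linear with
  | zero => simp
  | add f g hf hg => simp [← hf, ← hg]
  | single v c =>
    rw [act_single]
    simp [actX, shX, shB_apply]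

theorem bdd_const (d : Lau)
    (hd : ∀ χ : Lau →ₐ[ℂ] ℂ, (∀ v, ‖χ (mon v)‖ = 1) → χ d = 0 → ∀ v, χ (mon v) = 1)
    (w : ℤ × ℤ → ℂ) (C : ℝ) (hC : ∀ x, ‖w x‖ ≤ C) (hw : act d w = 0) (v x : ℤ × ℤ) :
    w (x - v) = w x := by
  have : CompleteSpace (solX d) := (solX_closed d).completeSpace_coe
  let wb : solX d := ⟨BoundedContinuousFunction.ofNormedAddCommGroup w continuous_of_discreteTopology C hC, hw⟩
  have h := laurent_gen (A := solX d →L[ℂ] solX d) (actX d) (fun v => by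
    refine ContinuousLinearMap.opNorm_le_bound _ zero_le_one (fun y => ?_)
    rw [one_mul]
    have : actX d (mon v) = shX d (Multiplicative.ofAdd v) := by simp [actX]
    rw [this]
    exact shB_norm v y.1) d (by
    ext w x
    rw [actX_coe]
    have : act d (⇑w.1) = 0 := w.2
    rw [this]; rfl) hd v
  have h2 := actX_coe d (mon v) wb x
  rw [h, act_single, one_mul] at h2
  exact h2.symm

end Action
section Uniq

lemma exists_angle (a : ℂ) (ha : ‖a‖ = 1) :
    ∃ θ : ℝ, θ ∈ Set.Ico (0:ℝ) (2*π) ∧ Complex.exp (Complex.I * θ) = a := by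
  have h := Complex.norm_mul_exp_arg_mul_I a
  rw [ha, Complex.ofReal_one, one_mul] at h
  by_cases hp : 0 ≤ a.arg
  · refine ⟨a.arg, ⟨hp, ?_⟩, by rw [mul_comm]; exact h⟩
    linarith [Complex.arg_le_pi a, Real.pi_pos]
  · refine ⟨a.arg + 2*π, ⟨?_, ?_⟩, ?_⟩
    · linarith [Complex.neg_pi_lt_arg a, Real.pi_pos]
    · linarith
    · push_cast
      rw [mul_add, show Complex.I * (2 * (π:ℂ)) = 2 * π * Complex.I by ring, Complex.exp_add,
        Complex.exp_two_pi_mul_I, mul_one, mul_comm]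
      exact h

lemma char_mon (χ : Lau →ₐ[ℂ] ℂ) (θ φ : ℝ) (h1 : Complex.exp (Complex.I * θ) = χ (mon (1,0)))
    (h2 : Complex.exp (Complex.I * φ) = χ (mon (0,1))) (v : ℤ × ℤ) :
    χ (mon v) = Complex.exp (Complex.I * ((v.1 : ℂ) * (θ : ℂ) + (v.2 : ℂ) * (φ : ℂ))) := by
  let g : Multiplicative (ℤ × ℤ) →* ℂ := (χ : Lau →* ℂ).comp (AddMonoidAlgebra.of ℂ (ℤ × ℤ))
  have hg : ∀ w, χ (mon w) = (g.toHomUnits (Multiplicative.ofAdd w) : ℂ) := fun w => rfl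
  have hv : Multiplicative.ofAdd v = (Multiplicative.ofAdd ((1:ℤ),(0:ℤ)))^v.1 * (Multiplicative.ofAdd ((0:ℤ),(1:ℤ)))^v.2 := by
    rw [← ofAdd_zsmul, ← ofAdd_zsmul, ← ofAdd_add]
    congr 1
    ext <;> simp
  rw [hg, hv, map_mul, map_zpow, map_zpow, Units.val_mul, Units.val_zpow_eq_zpow_val, Units.val_zpow_eq_zpow_val,
    ← hg, ← hg, ← h1, ← h2, ← Complex.exp_int_mul, ← Complex.exp_int_mul, ← Complex.exp_add]
  congr 1; ring

lemma conv_eq {m : ℕ} (k : ℤ × ℤ → Matrix (Fin m) (Fin m) ℂ)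
    (hfin : (Function.support k).Finite) (u : ℤ × ℤ → Fin m → ℂ) (v : ℤ × ℤ) :
    ∑ᶠ v' : ℤ × ℤ, (k (v - v')).mulVec (u v') = ∑ w ∈ hfin.toFinset, (k w).mulVec (u (v - w)) := by
  rw [← finsum_comp_equiv (Equiv.subLeft v)]
  simp only [Equiv.subLeft_apply, sub_sub_cancel]
  refine finsum_eq_sum_of_support_subset _ ?_
  intro w hw
  rw [Set.Finite.coe_toFinset, Function.mem_support]
  intro h
  apply hw
  simp [h]

lemma khat_eq {m : ℕ} (k : ℤ × ℤ → Matrix (Fin m) (Fin m) ℂ)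
    (hfin : (Function.support k).Finite) (g : ℤ × ℤ → ℂ) :
    ∑ᶠ v : ℤ × ℤ, g v • k v = ∑ v ∈ hfin.toFinset, g v • k v := by
  refine finsum_eq_sum_of_support_subset _ ?_
  intro w hw
  rw [Set.Finite.coe_toFinset, Function.mem_support]
  intro h
  apply hw
  simp [h]

theorem uniq_zero {m : ℕ} (k : ℤ × ℤ → Matrix (Fin m) (Fin m) ℂ)
    (hfin : (Function.support k).Finite)
    (Khat : ℝ → ℝ → Matrix (Fin m) (Fin m) ℂ)
    (hKhat : ∀ θ φ : ℝ, Khat θ φ =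
      ∑ᶠ v : ℤ × ℤ, Complex.exp (Complex.I * ((v.1 : ℂ) * (θ : ℂ) + (v.2 : ℂ) * (φ : ℂ))) • k v)
    (hinv : ∀ θ φ : ℝ, θ ∈ Set.Ico (0:ℝ) (2*π) → φ ∈ Set.Ico (0:ℝ) (2*π) →
      (θ, φ) ≠ (0, 0) → IsUnit (Khat θ φ))
    (u : ℤ × ℤ → Fin m → ℂ) (hu : Tendsto u (cocompact (ℤ × ℤ)) (nhds 0))
    (h0 : ∀ v : ℤ × ℤ, ∑ w ∈ hfin.toFinset, (k w).mulVec (u (v - w)) = 0) : u = 0 := by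
  let M : Matrix (Fin m) (Fin m) Lau := Matrix.of fun i j =>
    ∑ w ∈ hfin.toFinset, AddMonoidAlgebra.single w (k w i j)
  have hM : ∀ i, ∑ j, act (M i j) (fun x => u x j) = 0 := by
    intro i
    ext x
    have := congrFun (h0 x) i
    simp only [Finset.sum_apply, Matrix.mulVec, dotProduct] at this
    rw [Finset.sum_comm] at this
    rw [Finset.sum_apply]
    simp only [M, Matrix.of_apply, map_sum, LinearMap.sum_apply, Finset.sum_apply, act_single]
    exact this
  have hdet : ∀ j, act M.det (fun x => u x j) = 0 := by
    intro j
    have e : ∀ l, act ((M.adjugate * M) j l) (fun x => u x l)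
        = if j = l then act M.det (fun x => u x l) else 0 := by
      intro l
      rw [Matrix.adjugate_mul, Matrix.smul_apply, Matrix.one_apply]
      split_ifs <;> simp
    have e2 : ∑ l, act ((M.adjugate * M) j l) (fun x => u x l) = act M.det (fun x => u x j) := by
      simp only [e]; simp
    rw [← e2]
    simp only [Matrix.mul_apply, map_sum, LinearMap.sum_apply, map_mul, Module.End.mul_apply]
    rw [Finset.sum_comm]
    refine Finset.sum_eq_zero fun i _ => ?_
    rw [← map_sum, hM, map_zero]
  have hd : ∀ χ : Lau →ₐ[ℂ] ℂ, (∀ v, ‖χ (mon v)‖ = 1) → χ M.det = 0 → ∀ v, χ (mon v) = 1 := by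
    intro χ hn hz
    obtain ⟨θ, hθ, h1⟩ := exists_angle _ (hn (1,0))
    obtain ⟨φ, hφ, h2⟩ := exists_angle _ (hn (0,1))
    have hc := char_mon χ θ φ h1 h2
    have hmap : (M.map χ) = Khat θ φ := by
      rw [hKhat, khat_eq k hfin]
      ext i j
      rw [Matrix.map_apply, Matrix.sum_apply]
      simp only [M, Matrix.of_apply, map_sum, Matrix.smul_apply, smul_eq_mul]
      refine Finset.sum_congr rfl fun w _ => ?_
      rw [← hc w, mul_comm, ← smul_eq_mul, ← map_smul]
      congr 1
      simp [mon]
    have hdz : (Khat θ φ).det = 0 := by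
      rw [← hmap, ← hz, AlgHom.map_det]; rfl
    by_cases hne : (θ, φ) = (0, 0)
    · rw [Prod.mk.injEq] at hne
      obtain ⟨rfl, rfl⟩ := hne
      intro v
      rw [hc]; simp
    · have := hinv θ φ hθ hφ hne
      rw [Matrix.isUnit_iff_isUnit_det, hdz] at this
      simp at this
  rw [cocompact_eq_cofinite] at hu
  have hbd : ∀ j, ∃ C, ∀ x, ‖u x j‖ ≤ C := by
    intro j
    have h1 : Tendsto (fun x => ‖u x‖) cofinite (nhds 0) := by simpa using hu.norm
    have h2 := h1.eventually (gt_mem_nhds one_pos)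
    rw [eventually_cofinite] at h2
    refine ⟨1 + ∑ x ∈ h2.toFinset, ‖u x‖, fun x => (norm_le_pi_norm (u x) j).trans ?_⟩
    by_cases hx : ‖u x‖ < 1
    · have : 0 ≤ ∑ x ∈ h2.toFinset, ‖u x‖ := Finset.sum_nonneg fun _ _ => norm_nonneg _
      linarith
    · have := Finset.single_le_sum (f := fun x => ‖u x‖) (fun i _ => norm_nonneg _) (h2.mem_toFinset.2 hx)
      linarith
  ext x j
  obtain ⟨C, hC⟩ := hbd j
  have hconst : ∀ y, u y j = u x j := by
    intro y
    have := bdd_const M.det hd (fun x => u x j) C hC (hdet j) (x - y) x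
    simpa using this
  have ht : Tendsto (fun y => u y j) cofinite (nhds 0) := (tendsto_pi_nhds.1 hu) j
  simp only [hconst] at ht
  exact tendsto_nhds_unique tendsto_const_nhds ht

end Uniq
section Exist

noncomputable def ex (v : ℤ × ℤ) (p : ℝ × ℝ) : ℂ :=
  Complex.exp (Complex.I * ((v.1 : ℂ) * (p.1 : ℂ) + (v.2 : ℂ) * (p.2 : ℂ)))

lemma ex_norm (v : ℤ × ℤ) (p : ℝ × ℝ) : ‖ex v p‖ = 1 := by
  rw [ex, Complex.norm_exp]; simp

lemma ex_add (v w : ℤ × ℤ) (p : ℝ × ℝ) : ex (v + w) p = ex v p * ex w p := by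
  rw [ex, ex, ex, ← Complex.exp_add]; congr 1; push_cast [Prod.fst_add, Prod.snd_add]; ring

lemma ex_cont (v : ℤ × ℤ) : Continuous (ex v) := by unfold ex; fun_prop

def QQ : Set (ℝ × ℝ) := Set.Ioo (0:ℝ) (2*π) ×ˢ Set.Ioo (0:ℝ) (2*π)

lemma int1 (n : ℤ) : ∫ x : ℝ in Set.Ioo 0 (2*π), Complex.exp (Complex.I * ((n:ℂ) * (x:ℂ)))
    = if n = 0 then (2*π : ℂ) else 0 := by
  rw [← integral_Ioc_eq_integral_Ioo, ← intervalIntegral.integral_of_le (by positivity)]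
  split_ifs with h
  · subst h; simp
  · have hc : Complex.I * (n:ℂ) ≠ 0 := mul_ne_zero Complex.I_ne_zero (by exact_mod_cast h)
    simp only [← mul_assoc]
    rw [integral_exp_mul_complex hc]
    have : Complex.exp (Complex.I * n * ((2 * π : ℝ) : ℂ)) = 1 := by
      rw [Complex.exp_eq_one_iff]
      exact ⟨n, by push_cast; ring⟩
    rw [this]; simp

lemma int2 (v : ℤ × ℤ) : ∫ p in QQ, ex v p = if v = 0 then ((2*π : ℂ))^2 else 0 := by
  have h := setIntegral_prod_mul (μ := (volume : Measure ℝ)) (ν := (volume : Measure ℝ))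
    (fun x : ℝ => Complex.exp (Complex.I * ((v.1:ℂ) * (x:ℂ))))
    (fun x : ℝ => Complex.exp (Complex.I * ((v.2:ℂ) * (x:ℂ)))) (Set.Ioo 0 (2*π)) (Set.Ioo 0 (2*π))
  rw [int1, int1] at h
  have e : ∀ p, ex v p = Complex.exp (Complex.I * ((v.1:ℂ) * (p.1:ℂ))) *
      Complex.exp (Complex.I * ((v.2:ℂ) * (p.2:ℂ))) := by
    intro p; rw [ex, ← Complex.exp_add, mul_add]
  simp only [e]
  refine h.trans ?_
  obtain ⟨a, b⟩ := v
  by_cases ha : a = 0 <;> by_cases hb : b = 0 <;> simp [ha, hb, sq]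

lemma summ1 : Summable (fun n : ℤ => 1 / (1 + (n:ℝ)^2)) := by
  have h := Real.summable_one_div_int_pow.2 (show 1 < 2 by norm_num)
  refine Summable.of_norm_bounded_eventually h ?_
  rw [eventually_cofinite]
  refine (Set.finite_singleton (0:ℤ)).subset fun n hn => ?_
  by_contra hne
  apply hn
  have h0 : (n:ℝ) ≠ 0 := by exact_mod_cast hne
  have : 0 < (n:ℝ)^2 := by positivity
  rw [Real.norm_of_nonneg (by positivity)]
  gcongr
  linarith

lemma bdd_of_tendsto {E : Type*} [NormedAddCommGroup E] (g : ℤ × ℤ → E)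
    (h : Tendsto g cofinite (nhds 0)) : ∃ C, ∀ x, ‖g x‖ ≤ C := by
  have h1 : Tendsto (fun x => ‖g x‖) cofinite (nhds 0) := by simpa using h.norm
  have h2 := h1.eventually (gt_mem_nhds one_pos)
  rw [eventually_cofinite] at h2
  refine ⟨1 + ∑ x ∈ h2.toFinset, ‖g x‖, fun x => ?_⟩
  by_cases hx : ‖g x‖ < 1
  · have : 0 ≤ ∑ x ∈ h2.toFinset, ‖g x‖ := Finset.sum_nonneg fun _ _ => norm_nonneg _
    linarith
  · have := Finset.single_le_sum (f := fun x => ‖g x‖) (fun i _ => norm_nonneg _) (h2.mem_toFinset.2 hx)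
    linarith

lemma f_summable {m : ℕ} (f : ℤ × ℤ → Fin m → ℂ)
    (hf : ∀ p q : ℕ, Tendsto (fun v : ℤ × ℤ => ((v.1 : ℝ)^p * (v.2 : ℝ)^q) • f v)
      (cocompact (ℤ × ℤ)) (nhds 0)) : Summable (fun v => ‖f v‖) := by
  rw [cocompact_eq_cofinite] at hf
  obtain ⟨C1, h1⟩ := bdd_of_tendsto _ (hf 0 0)
  obtain ⟨C2, h2⟩ := bdd_of_tendsto _ (hf 2 0)
  obtain ⟨C3, h3⟩ := bdd_of_tendsto _ (hf 0 2)
  obtain ⟨C4, h4⟩ := bdd_of_tendsto _ (hf 2 2)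
  have hs := (summ1.mul_of_nonneg summ1 (fun n => by positivity) (fun n => by positivity)).mul_left
    (C1 + C2 + C3 + C4)
  refine Summable.of_nonneg_of_le (fun _ => norm_nonneg _) (fun v => ?_) hs
  have e1 := h1 v
  have e2 := h2 v
  have e3 := h3 v
  have e4 := h4 v
  rw [norm_smul, Real.norm_of_nonneg (by positivity)] at e1 e2 e3 e4
  rw [one_div_mul_one_div, mul_one_div, le_div_iff₀ (by positivity)]
  nlinarith

lemma rl {E : Type*} [NormedAddCommGroup E] [NormedSpace ℂ E] (H : ℝ × ℝ → E) :
    Tendsto (fun v : ℤ × ℤ => ∫ p in QQ, ex (-v) p • H p) cofinite (nhds 0) := by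
  let Lm : ℤ × ℤ → StrongDual ℝ (ℝ × ℝ) := fun v =>
    ((v.1 : ℝ) / (2*π)) • ContinuousLinearMap.fst ℝ ℝ ℝ + ((v.2 : ℝ) / (2*π)) • ContinuousLinearMap.snd ℝ ℝ ℝ
  have hL : Tendsto Lm cofinite (cocompact _) := by
    rw [← Metric.cobounded_eq_cocompact, ← tendsto_norm_atTop_iff_cobounded]
    have hb : ∀ v, ‖v‖ / (2*π) ≤ ‖Lm v‖ := by
      intro v
      have a1 := (Lm v).le_opNorm (1,0)
      have a2 := (Lm v).le_opNorm (0,1)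
      simp [Lm, Prod.norm_def] at a1 a2
      rw [abs_of_pos Real.pi_pos] at a1 a2
      rw [Prod.norm_def, Int.norm_eq_abs, Int.norm_eq_abs]
      rcases max_cases |(v.1:ℝ)| |(v.2:ℝ)| with ⟨h, _⟩ | ⟨h, _⟩
      · rw [h]; exact a1
      · rw [h]; exact a2
    refine tendsto_atTop_mono hb ?_
    refine Tendsto.atTop_div_const (by positivity) ?_
    rw [← cocompact_eq_cofinite]
    exact tendsto_norm_cocompact_atTop
  have h := (tendsto_integral_exp_smul_cocompact (QQ.indicator H) (volume : Measure (ℝ × ℝ))).comp hL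
  refine h.congr fun v => ?_
  have hmeas : MeasurableSet QQ := measurableSet_Ioo.prod measurableSet_Ioo
  rw [← integral_indicator hmeas]
  simp only [Function.comp]
  congr 1
  ext p
  by_cases hp : p ∈ QQ
  · rw [Set.indicator_of_mem hp, Set.indicator_of_mem hp, Circle.smul_def]
    congr 1
    rw [Real.fourierChar_apply, ex]
    congr 1
    simp [Lm]
    have : (π : ℂ) ≠ 0 := by exact_mod_cast Real.pi_ne_zero
    field_simp
    ring
  · rw [Set.indicator_of_notMem hp, Set.indicator_of_notMem hp, smul_zero]

theorem exist {m : ℕ} (k : ℤ × ℤ → Matrix (Fin m) (Fin m) ℂ)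
    (hfin : (Function.support k).Finite)
    (Khat : ℝ → ℝ → Matrix (Fin m) (Fin m) ℂ)
    (hK : ∀ p : ℝ × ℝ, Khat p.1 p.2 = ∑ v ∈ hfin.toFinset, ex v p • k v)
    (hinv : ∀ p ∈ QQ, IsUnit (Khat p.1 p.2))
    (hint : IntegrableOn (fun p : ℝ × ℝ => ‖(Khat p.1 p.2)⁻¹‖) QQ)
    (f : ℤ × ℤ → Fin m → ℂ) (hf : Summable (fun v => ‖f v‖)) :
    ∃ u : ℤ × ℤ → Fin m → ℂ, Tendsto u cofinite (nhds 0) ∧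
      ∀ v : ℤ × ℤ, ∑ w ∈ hfin.toFinset, (k w).mulVec (u (v - w)) = f v := by
  have hmeas : MeasurableSet QQ := measurableSet_Ioo.prod measurableSet_Ioo
  have hfinQ : IsFiniteMeasure ((volume : Measure (ℝ × ℝ)).restrict QQ) := by
    refine ⟨?_⟩
    rw [Measure.restrict_apply_univ]
    have hb : Bornology.IsBounded QQ := (Metric.isBounded_Ioo _ _).prod (Metric.isBounded_Ioo _ _)
    exact hb.measure_lt_top
  let fh : ℝ × ℝ → Fin m → ℂ := fun p => ∑' v, ex v p • f v
  have hterm : ∀ v p, ‖ex v p • f v‖ ≤ ‖f v‖ := fun v p => by rw [norm_smul, ex_norm, one_mul]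
  have hfc : Continuous fh :=
    continuous_tsum (fun v => (ex_cont v).smul continuous_const) hf hterm
  have hfb : ∀ p, ‖fh p‖ ≤ ∑' v, ‖f v‖ := fun p => tsum_of_norm_bounded hf.hasSum (fun v => hterm v p)
  let H : ℝ × ℝ → Fin m → ℂ := fun p => (Khat p.1 p.2)⁻¹.mulVec (fh p)
  have hKc : Continuous (fun p : ℝ × ℝ => Khat p.1 p.2) := by
    simp only [hK]
    exact continuous_finsetSum _ fun v _ => (ex_cont v).smul continuous_const
  have hHi : Integrable H (volume.restrict QQ) := by
    refine Integrable.of_eval fun i => ?_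
    simp only [H, Matrix.mulVec, dotProduct]
    refine integrable_finsetSum _ fun j _ => ?_
    refine Integrable.mul_bdd (c := ∑' v, ‖f v‖) ?_ ?_ ?_
    · refine Integrable.mono' hint ?_ (Eventually.of_forall fun p => Matrix.norm_entry_le_entrywise_sup_norm _)
      have : (fun p : ℝ × ℝ => (Khat p.1 p.2)⁻¹ i j)
          = fun p => ((Khat p.1 p.2).det)⁻¹ * (Khat p.1 p.2).adjugate i j := by
        ext p
        rw [Matrix.inv_def, Matrix.smul_apply, Ring.inverse_eq_inv', smul_eq_mul]
      rw [this]
      refine Measurable.aestronglyMeasurable ?_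
      refine (hKc.matrix_det.measurable.inv).mul ?_
      exact ((hKc.matrix_adjugate).matrix_elem i j).measurable
    · exact ((continuous_apply j).comp hfc).aestronglyMeasurable
    · exact Eventually.of_forall fun p => (norm_le_pi_norm (fh p) j).trans (hfb p)
  have hexi : ∀ v, Integrable (fun p => ex v p • H p) (volume.restrict QQ) := fun v =>
    hHi.bdd_smul 1 (ex_cont v).aestronglyMeasurable (Eventually.of_forall fun p => (ex_norm v p).le)
  let c : ℂ := ((2*π : ℂ)^2)⁻¹
  have hc : c * (2*π : ℂ)^2 = 1 := by
    refine inv_mul_cancel₀ ?_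
    have : (π : ℂ) ≠ 0 := by exact_mod_cast Real.pi_ne_zero
    exact pow_ne_zero _ (mul_ne_zero two_ne_zero this)
  refine ⟨fun v => c • ∫ p in QQ, ex (-v) p • H p, ?_, fun v => ?_⟩
  · have := (rl H).const_smul c
    simpa using this
  · have e1 : ∀ w, (k w).mulVec (c • ∫ p in QQ, ex (-(v - w)) p • H p)
        = c • ∫ p in QQ, (k w).mulVec (ex (-(v - w)) p • H p) := by
      intro w
      rw [Matrix.mulVec_smul]
      congr 1
      exact ((Matrix.mulVecLin (k w)).toContinuousLinearMap.integral_comp_comm (hexi (-(v-w)))).symm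
    have hi : ∀ w ∈ hfin.toFinset, Integrable (fun p => (k w).mulVec (ex (-(v - w)) p • H p)) (volume.restrict QQ) :=
      fun w _ => (Matrix.mulVecLin (k w)).toContinuousLinearMap.integrable_comp (hexi (-(v-w)))
    simp only [e1]
    rw [← Finset.smul_sum, ← integral_finsetSum _ hi]
    have e2 : ∀ p ∈ QQ, ∑ w ∈ hfin.toFinset, (k w).mulVec (ex (-(v - w)) p • H p)
        = ∑' w, ex (w - v) p • f w := by
      intro p hp
      have a1 : ∑ w ∈ hfin.toFinset, (k w).mulVec (ex (-(v - w)) p • H p)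
          = ex (-v) p • ((Khat p.1 p.2).mulVec (H p)) := by
        rw [hK, Matrix.sum_mulVec, Finset.smul_sum]
        refine Finset.sum_congr rfl fun w _ => ?_
        rw [Matrix.mulVec_smul, Matrix.smul_mulVec, smul_smul, ← ex_add]
        congr 2; abel
      rw [a1]
      simp only [H]
      rw [Matrix.mulVec_mulVec, Matrix.mul_nonsing_inv _ ((Matrix.isUnit_iff_isUnit_det _).1 (hinv p hp)),
        Matrix.one_mulVec]
      simp only [fh]
      rw [← tsum_const_smul'']
      congr 1; ext1 w
      rw [smul_smul, ← ex_add, neg_add_eq_sub]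
    rw [setIntegral_congr_fun hmeas e2]
    have hs := hasSum_integral_of_summable_integral_norm (μ := volume.restrict QQ)
      (F := fun w p => ex (w - v) p • f w) (fun w => by
        refine Integrable.smul_const ?_ _
        exact (integrable_const (1:ℝ)).mono' (ex_cont _).aestronglyMeasurable
          (Eventually.of_forall fun p => (ex_norm _ p).le)) (by
        simp only [norm_smul, ex_norm, one_mul, integral_const]
        simpa using hf.mul_left _)
    have hs2 : HasSum (fun w => ∫ p in QQ, ex (w - v) p • f w) ((2*π : ℂ)^2 • f v) := by
      simp only [integral_smul_const, int2]
      convert hasSum_single v ?_ using 1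
      · simp
      · intro w hw
        rw [if_neg (sub_ne_zero.2 hw), zero_smul]
    rw [hs.unique hs2, smul_smul, hc, one_smul]

end Exist



/-- Existence and uniqueness of the inverse of a finitely supported, skew-symmetric,
translation-invariant (Kasteleyn-type) operator on `ℤ²`, given invertibility of its symbol
away from `(0,0)` and integrability of the inverse symbol. -/
theorem stmt0 (m : ℕ) (hm : 1 ≤ m) (k : ℤ × ℤ → Matrix (Fin m) (Fin m) ℂ)
    (hfin : (Function.support k).Finite)
    (hskew : ∀ v : ℤ × ℤ, (k (-v)).transpose = - k v)
    (Khat : ℝ → ℝ → Matrix (Fin m) (Fin m) ℂ)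
    (hKhat : ∀ θ φ : ℝ, Khat θ φ =
      ∑ᶠ v : ℤ × ℤ, Complex.exp (Complex.I * ((v.1 : ℂ) * (θ : ℂ) + (v.2 : ℂ) * (φ : ℂ))) • k v)
    (hinv : ∀ θ φ : ℝ, θ ∈ Set.Ico (0:ℝ) (2*π) → φ ∈ Set.Ico (0:ℝ) (2*π) →
      (θ, φ) ≠ (0, 0) → IsUnit (Khat θ φ))
    (hint : IntegrableOn (fun p : ℝ × ℝ => ‖(Khat p.1 p.2)⁻¹‖)
      (Set.Icc (0:ℝ) (2*π) ×ˢ Set.Icc (0:ℝ) (2*π)))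
    (f : ℤ × ℤ → Fin m → ℂ)
    (hf : ∀ p q : ℕ, Tendsto (fun v : ℤ × ℤ => ((v.1 : ℝ)^p * (v.2 : ℝ)^q) • f v)
      (cocompact (ℤ × ℤ)) (nhds 0)) :
    ∃! u : ℤ × ℤ → Fin m → ℂ,
      Tendsto u (cocompact (ℤ × ℤ)) (nhds 0) ∧
      ∀ v : ℤ × ℤ, ∑ᶠ v' : ℤ × ℤ, (k (v - v')).mulVec (u v') = f v := by
  have hsub : QQ ⊆ Set.Icc (0:ℝ) (2*π) ×ˢ Set.Icc (0:ℝ) (2*π) :=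
    Set.prod_mono Set.Ioo_subset_Icc_self Set.Ioo_subset_Icc_self
  obtain ⟨u, hu, hk⟩ := exist k hfin Khat (fun p => by rw [hKhat, khat_eq k hfin]; rfl)
    (fun p hp => hinv p.1 p.2 (Set.Ioo_subset_Ico_self hp.1) (Set.Ioo_subset_Ico_self hp.2) (fun h => by
      rw [Prod.mk.injEq] at h
      exact hp.1.1.ne' h.1)) (hint.mono_set hsub) f (f_summable f hf)
  refine ⟨u, ⟨by rw [cocompact_eq_cofinite]; exact hu, fun v => by rw [conv_eq k hfin]; exact hk v⟩, ?_⟩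
  rintro u' ⟨hu', hk'⟩
  rw [← cocompact_eq_cofinite] at hu
  have := uniq_zero k hfin Khat hKhat hinv (u' - u) (by rw [← sub_zero (0 : Fin m → ℂ)]; exact hu'.sub hu) (fun v => by
    have h1 := hk' v
    rw [conv_eq k hfin] at h1
    simp only [Pi.sub_apply, Matrix.mulVec_sub, Finset.sum_sub_distrib]
    rw [h1, hk, sub_self])
  exact sub_eq_zero.1 this
end

section
/- Let G be a finite simple graph with vertex set V and edge set E, and let J : E → ℝ. Then ∑_{σ : V → {−1,1}} ∏_{e={u,v}∈E} exp(J_e σ(u) σ(v)) = 2^{|V|} · (∏_{e∈E} cosh J_e) · ∑_{S} ∏_{e∈S} tanh J_e, where the last sum is over all subsets S ⊆ E such that every vertex of G is incident to an even number of edges of S. -/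
open Finset

/-- The product of the spins at the two endpoints of an (unordered) edge. -/
def spinProd {V : Type*} (σ : V → ℤˣ) : Sym2 V → ℝ :=
  Sym2.lift ⟨fun u v => ((σ u : ℤ) : ℝ) * ((σ v : ℤ) : ℝ), fun u v => by ring⟩

theorem spinProd_eq_prod {V : Type*} [Fintype V] [DecidableEq V] (σ : V → ℤˣ) (e : Sym2 V)
    (he : ¬ e.IsDiag) :
    spinProd σ e = ∏ v, if v ∈ e then ((σ v : ℤ) : ℝ) else 1 := by
  induction e using Sym2.ind with
  | _ a b =>
    have hab : a ≠ b := by simpa using he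
    rw [← Finset.prod_filter]
    have : (univ.filter (fun v => v ∈ s(a, b))) = {a, b} := by
      ext v; simp
    rw [this, Finset.prod_pair hab]
    rfl

theorem exp_spin (σ : ℝ) (h : σ = 1 ∨ σ = -1) (j : ℝ) :
    Real.exp (j * σ) = Real.cosh j * (1 + Real.tanh j * σ) := by
  have hc : Real.cosh j ≠ 0 := (Real.cosh_pos j).ne'
  rw [Real.tanh_eq_sinh_div_cosh]
  rcases h with rfl | rfl
  · field_simp
    rw [← Real.cosh_add_sinh]
  · field_simp
    rw [← Real.cosh_sub_sinh]
    ring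

theorem spinProd_pm {V : Type*} (σ : V → ℤˣ) (e : Sym2 V) :
    spinProd σ e = 1 ∨ spinProd σ e = -1 := by
  induction e using Sym2.ind with
  | _ a b =>
    change ((σ a : ℤ) : ℝ) * ((σ b : ℤ) : ℝ) = 1 ∨ ((σ a : ℤ) : ℝ) * ((σ b : ℤ) : ℝ) = -1
    rcases Int.units_eq_one_or (σ a) with h | h <;>
      rcases Int.units_eq_one_or (σ b) with h' | h' <;> simp [h, h']

theorem sum_units_pow (n : ℕ) :
    ∑ s : ℤˣ, ((s : ℤ) : ℝ) ^ n = if Even n then 2 else 0 := by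
  have : (univ : Finset ℤˣ) = {1, -1} := rfl
  rw [this, Finset.sum_pair (by decide)]
  split_ifs with h
  · simp [h.neg_pow]; norm_num
  · simp [(Nat.not_even_iff_odd.mp h).neg_pow]

theorem sum_prod_spinProd {V : Type*} [Fintype V] [DecidableEq V] (S : Finset (Sym2 V))
    (hS : ∀ e ∈ S, ¬ e.IsDiag) :
    ∑ σ : V → ℤˣ, ∏ e ∈ S, spinProd σ e =
      if ∀ v : V, Even ((S.filter (fun e => v ∈ e)).card) then 2 ^ Fintype.card V else 0 := by
  have h1 : ∀ σ : V → ℤˣ, ∏ e ∈ S, spinProd σ e =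
      ∏ v, ((σ v : ℤ) : ℝ) ^ ((S.filter (fun e => v ∈ e)).card) := by
    intro σ
    rw [Finset.prod_congr rfl (fun e he => spinProd_eq_prod σ e (hS e he)), Finset.prod_comm]
    refine Finset.prod_congr rfl fun v _ => ?_
    rw [← Finset.prod_filter, Finset.prod_const]
  simp_rw [h1]
  have h2 := (Fintype.prod_sum (fun (v : V) (s : ℤˣ) =>
    ((s : ℤ) : ℝ) ^ ((S.filter (fun e => v ∈ e)).card))).symm
  rw [h2]
  simp_rw [sum_units_pow]
  split_ifs with h
  · simp [h]
  · push Not at h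
    obtain ⟨v, hv⟩ := h
    exact Finset.prod_eq_zero (mem_univ v) (by simp [hv])

/-- High-temperature expansion of the Ising partition function: the sum over spin
configurations of `∏_e exp(J_e σ_u σ_v)` equals `2^|V| ∏_e cosh(J_e)` times the sum over
even subsets of edges of `∏_{e ∈ S} tanh(J_e)`. -/
theorem stmt8 (V : Type*) [Fintype V] [DecidableEq V] (G : SimpleGraph V)
    [DecidableRel G.Adj] (J : Sym2 V → ℝ) :
    ∑ σ : V → ℤˣ, ∏ e ∈ G.edgeFinset, Real.exp (J e * spinProd σ e) =
      2 ^ Fintype.card V * (∏ e ∈ G.edgeFinset, Real.cosh (J e)) *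
        ∑ S ∈ G.edgeFinset.powerset.filter
            (fun S => ∀ v : V, Even ((S.filter (fun e => v ∈ e)).card)),
          ∏ e ∈ S, Real.tanh (J e) := by
  have h1 : ∀ σ : V → ℤˣ, ∏ e ∈ G.edgeFinset, Real.exp (J e * spinProd σ e) =
      (∏ e ∈ G.edgeFinset, Real.cosh (J e)) *
        ∑ S ∈ G.edgeFinset.powerset, (∏ e ∈ S, Real.tanh (J e)) * ∏ e ∈ S, spinProd σ e := by
    intro σ
    rw [Finset.prod_congr rfl (fun e _ => exp_spin _ (spinProd_pm σ e) (J e)),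
      Finset.prod_mul_distrib, Finset.prod_one_add]
    simp_rw [Finset.prod_mul_distrib]
  simp_rw [h1]
  rw [← Finset.mul_sum, Finset.sum_comm, mul_comm (2 ^ Fintype.card V : ℝ), mul_assoc,
    Finset.sum_filter, Finset.mul_sum (a := (_ ^ _ : ℝ))]
  congr 1
  refine Finset.sum_congr rfl fun S hS => ?_
  rw [← Finset.mul_sum, sum_prod_spinProd S]
  · split_ifs <;> ring
  · intro e he
    exact G.not_isDiag_of_mem_edgeFinset (Finset.mem_powerset.mp hS he)
end

section
/- Let h : ℝ² → ℂ be 2π-periodic in each variable, continuously differentiable on ℝ² \ 2πℤ², and suppose there is a constant C > 0 such that for all (θ,φ) ∈ (−π,π]² with 0 < ‖(θ,φ)‖ ≤ π one has |h(θ,φ)| ≤ C/‖(θ,φ)‖ and ‖∇h(θ,φ)‖ ≤ C/‖(θ,φ)‖². Then h is integrable on [0,2π]² and lim_{n→∞} (1/n²) ∑_{j=0}^{n−1} ∑_{k=0}^{n−1} h((2j+1)π/n, 2kπ/n) = (1/(4π²)) ∫₀^{2π} ∫₀^{2π} h(θ,φ) dθ dφ. -/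
open Real Filter MeasureTheory Finset

/-- One-variable dominating function. -/
noncomputable def domG (x : ℝ) : ℝ := x ^ (-(1/2) : ℝ) + (2*π - x) ^ (-(1/2) : ℝ)

lemma domG_integrable : IntegrableOn domG (Set.Ioc (0:ℝ) (2*π)) := by
  have h1 : IntervalIntegrable (fun x : ℝ => x ^ (-(1/2) : ℝ)) volume 0 (2*π) :=
    intervalIntegral.intervalIntegrable_rpow' (by norm_num)
  have h2 := h1.comp_sub_left (2*π)
  simp only [sub_zero, sub_self] at h2
  have h3 := h1.add h2.symm
  rw [intervalIntegrable_iff_integrableOn_Ioc_of_le (by positivity)] at h3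
  exact h3

lemma domG_integrable2 : IntegrableOn (fun p : ℝ × ℝ => domG p.1 * domG p.2)
    (Set.Ioo (0:ℝ) (2*π) ×ˢ Set.Ioo (0:ℝ) (2*π)) := by
  have h := domG_integrable.mono_set (Set.Ioo_subset_Ioc_self)
  have := Integrable.mul_prod h h
  unfold IntegrableOn
  rw [Measure.volume_eq_prod, ← Measure.prod_restrict]
  exact this

lemma corner_choice (q : ℝ) (hq0 : 0 ≤ q) (hq1 : q ≤ 2*π) :
    ∃ c : ℝ, (c = 0 ∨ c = 2*π) ∧ q - c ∈ Set.Ioc (-π) π := by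
  have := Real.pi_pos
  rcases le_or_gt q π with h | h
  · exact ⟨0, Or.inl rfl, by constructor <;> linarith⟩
  · exact ⟨2*π, Or.inr rfl, by constructor <;> linarith⟩

lemma corner_domG (p c : ℝ) (hp : p ∈ Set.Ioo 0 (2*π)) (hc : c = 0 ∨ c = 2*π) :
    0 < |p - c| ∧ |p - c| ^ (-(1/2) : ℝ) ≤ domG p := by
  obtain ⟨h0, h1⟩ := hp
  have ha : 0 ≤ p ^ (-(1/2) : ℝ) := Real.rpow_nonneg h0.le _
  have hb : 0 ≤ (2*π - p) ^ (-(1/2) : ℝ) := Real.rpow_nonneg (by linarith) _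
  unfold domG
  rcases hc with rfl | rfl
  · rw [sub_zero, abs_of_pos h0]; exact ⟨h0, by linarith⟩
  · rw [abs_of_neg (by linarith), neg_sub]; exact ⟨by linarith, by linarith⟩

lemma key_bound (h : ℝ × ℝ → ℂ)
    (hper1 : ∀ θ φ : ℝ, h (θ + 2*π, φ) = h (θ, φ))
    (hper2 : ∀ θ φ : ℝ, h (θ, φ + 2*π) = h (θ, φ))
    (C : ℝ) (hC : 0 < C)
    (hbound : ∀ p : ℝ × ℝ, p.1 ∈ Set.Ioc (-π) π → p.2 ∈ Set.Ioc (-π) π →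
      0 < ‖p‖ → ‖p‖ ≤ π → ‖h p‖ ≤ C / ‖p‖)
    (p q : ℝ × ℝ) (hp1 : p.1 ∈ Set.Ioo 0 (2*π)) (hp2 : p.2 ∈ Set.Ioo 0 (2*π))
    (hq1 : q.1 ∈ Set.Icc 0 (2*π)) (hq2 : q.2 ∈ Set.Icc 0 (2*π))
    (hpq : ∀ c1 c2 : ℝ, (c1 = 0 ∨ c1 = 2*π) → (c2 = 0 ∨ c2 = 2*π) →
      ‖p - (c1, c2)‖ ≤ 3 * ‖q - (c1, c2)‖) :
    ‖h q‖ ≤ 3 * C * (domG p.1 * domG p.2) := by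
  obtain ⟨c1, hc1, hm1⟩ := corner_choice q.1 hq1.1 hq1.2
  obtain ⟨c2, hc2, hm2⟩ := corner_choice q.2 hq2.1 hq2.2
  obtain ⟨a0, a1⟩ := corner_domG p.1 c1 hp1 hc1
  obtain ⟨b0, b1⟩ := corner_domG p.2 c2 hp2 hc2
  have hle := hpq c1 c2 hc1 hc2
  set N := ‖p - (c1, c2)‖ with hN
  have e1 : |p.1 - c1| ≤ N := norm_fst_le (p - (c1, c2))
  have e2 : |p.2 - c2| ≤ N := norm_snd_le (p - (c1, c2))
  have hN0 : 0 < N := lt_of_lt_of_le a0 e1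
  have hM0 : 0 < ‖q - (c1, c2)‖ := by linarith
  have hMpi : ‖q - (c1, c2)‖ ≤ π := by
    rw [Prod.norm_def]
    exact max_le (abs_le.2 ⟨hm1.1.le, hm1.2⟩) (abs_le.2 ⟨hm2.1.le, hm2.2⟩)
  have hh : h q = h (q - (c1, c2)) := by
    have s1 : ∀ x y, h (x - c1, y) = h (x, y) := by
      intro x y
      rcases hc1 with rfl | rfl
      · simp
      · rw [← hper1, sub_add_cancel]
    have s2 : ∀ x y, h (x, y - c2) = h (x, y) := by
      intro x y
      rcases hc2 with rfl | rfl
      · simp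
      · rw [← hper2, sub_add_cancel]
    have : q - (c1, c2) = (q.1 - c1, q.2 - c2) := rfl
    rw [this, s1, s2]
  rw [hh]
  have hb := hbound (q - (c1, c2)) hm1 hm2 hM0 hMpi
  have f1 : C / ‖q - (c1, c2)‖ ≤ 3 * C * N⁻¹ := by
    rw [← div_eq_mul_inv, div_le_div_iff₀ hM0 hN0]
    nlinarith
  have f2 : N⁻¹ = N ^ (-(1/2) : ℝ) * N ^ (-(1/2) : ℝ) := by
    rw [← Real.rpow_add hN0, ← Real.rpow_neg_one]; norm_num
  have g1 : N ^ (-(1/2) : ℝ) ≤ domG p.1 :=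
    (Real.rpow_le_rpow_of_nonpos a0 e1 (by norm_num)).trans a1
  have g2 : N ^ (-(1/2) : ℝ) ≤ domG p.2 :=
    (Real.rpow_le_rpow_of_nonpos b0 e2 (by norm_num)).trans b1
  have hn := Real.rpow_nonneg hN0.le (-(1/2) : ℝ)
  have f3 : N⁻¹ ≤ domG p.1 * domG p.2 := by
    rw [f2]; exact mul_le_mul g1 g2 hn (hn.trans g1)
  calc _ ≤ _ := hb
    _ ≤ _ := f1
    _ ≤ _ := by gcongr

/-- index of the cell containing `x` -/
noncomputable def idx (n : ℕ) (x : ℝ) : ℕ := ⌊(n:ℝ) * x / (2*π)⌋₊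

noncomputable def gridpt (n : ℕ) (p : ℝ × ℝ) : ℝ × ℝ :=
  ((2*(idx n p.1 : ℝ)+1)*π/(n:ℝ), 2*(idx n p.2 : ℝ)*π/(n:ℝ))

lemma idx_bounds (n : ℕ) (hn : 0 < n) (x : ℝ) (hx : x ∈ Set.Ico 0 (2*π)) :
    idx n x < n ∧ 2*(idx n x : ℝ)*π/n ≤ x ∧ x < 2*((idx n x : ℝ)+1)*π/n := by
  have hpi := Real.pi_pos
  have hn' : (0:ℝ) < n := by exact_mod_cast hn
  have h0 : 0 ≤ (n:ℝ) * x / (2*π) := by have := hx.1; positivity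
  have h1 := Nat.floor_le h0
  have h2 := Nat.lt_floor_add_one ((n:ℝ) * x / (2*π))
  refine ⟨?_, ?_, ?_⟩
  · unfold idx
    rw [Nat.floor_lt h0, div_lt_iff₀ (by positivity)]
    exact mul_lt_mul_of_pos_left hx.2 hn'
  · rw [le_div_iff₀ (by positivity)] at h1
    rw [div_le_iff₀ hn']
    unfold idx; nlinarith
  · rw [div_lt_iff₀ (by positivity)] at h2
    rw [lt_div_iff₀ hn']
    unfold idx; nlinarith

lemma idx_eq (n : ℕ) (hn : 0 < n) (j : ℕ) (x : ℝ)
    (hx : x ∈ Set.Ico (2*(j:ℝ)*π/n) (2*((j:ℝ)+1)*π/n)) : idx n x = j := by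
  have hpi := Real.pi_pos
  have hn' : (0:ℝ) < n := by exact_mod_cast hn
  obtain ⟨h1, h2⟩ := hx
  rw [div_le_iff₀ hn'] at h1
  rw [lt_div_iff₀ hn'] at h2
  have hx0 : 0 ≤ (n:ℝ) * x := by nlinarith [mul_nonneg (Nat.cast_nonneg (α := ℝ) j) hpi.le]
  unfold idx
  rw [Nat.floor_eq_iff (by positivity), le_div_iff₀ (by positivity), div_lt_iff₀ (by positivity)]
  constructor <;> nlinarith

lemma measurable_idx (n : ℕ) : Measurable (idx n) := by
  have h1 : Measurable (fun x : ℝ => (n:ℝ) * x / (2*π)) := by fun_prop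
  exact Nat.measurable_floor.comp h1

lemma measurable_idx_pair (n : ℕ) (F : ℕ × ℕ → ℂ) :
    Measurable (fun p : ℝ × ℝ => F (idx n p.1, idx n p.2)) := by
  have h2 : Measurable (fun p : ℝ × ℝ => (idx n p.1, idx n p.2)) :=
    ((measurable_idx n).comp measurable_fst).prodMk ((measurable_idx n).comp measurable_snd)
  have h3 : Measurable F := measurable_of_countable F
  exact h3.comp h2

lemma measurable_gridpt_comp (h : ℝ × ℝ → ℂ) (n : ℕ) : Measurable (fun p => h (gridpt n p)) := by
  unfold gridpt
  exact measurable_idx_pair n (fun m : ℕ × ℕ =>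
    h ((2*(m.1 : ℝ)+1)*π/(n:ℝ), 2*(m.2 : ℝ)*π/(n:ℝ)))

lemma integral_grid (h : ℝ × ℝ → ℂ) (n : ℕ) (hn : 0 < n) :
    ∫ p in Set.Ico (0:ℝ) (2*π) ×ˢ Set.Ico (0:ℝ) (2*π), h (gridpt n p) =
    (2*π/n : ℂ)^2 *
      ∑ j ∈ range n, ∑ k ∈ range n, h ((2*(j:ℝ)+1)*π/(n:ℝ), 2*(k:ℝ)*π/(n:ℝ)) := by
  have hpi := Real.pi_pos
  have hn' : (0:ℝ) < n := by exact_mod_cast hn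
  let I : ℕ → Set ℝ := fun j => Set.Ico (2*(j:ℝ)*π/n) (2*((j:ℝ)+1)*π/n)
  let cell : ℕ × ℕ → Set (ℝ × ℝ) := fun m => I m.1 ×ˢ I m.2
  have hS : Set.Ico (0:ℝ) (2*π) ×ˢ Set.Ico (0:ℝ) (2*π) =
      ⋃ m ∈ range n ×ˢ range n, cell m := by
    have hsub : ∀ j < n, I j ⊆ Set.Ico 0 (2*π) := by
      intro j hj
      apply Set.Ico_subset_Ico
      · positivity
      · rw [div_le_iff₀ hn']
        have : (j:ℝ) + 1 ≤ n := by exact_mod_cast hj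
        nlinarith
    ext p
    simp only [Set.mem_iUnion, Finset.mem_product, Finset.mem_range, exists_prop]
    constructor
    · rintro ⟨h1, h2⟩
      obtain ⟨a, b⟩ := idx_bounds n hn _ h1
      obtain ⟨c, d⟩ := idx_bounds n hn _ h2
      exact ⟨(idx n p.1, idx n p.2), ⟨a, c⟩, b, d⟩
    · rintro ⟨m, ⟨h1, h2⟩, h3, h4⟩
      exact ⟨hsub _ h1 h3, hsub _ h2 h4⟩
  have hmeas : ∀ m, MeasurableSet (cell m) := fun m => measurableSet_Ico.prod measurableSet_Ico
  have heq : ∀ m : ℕ × ℕ, Set.EqOn (fun p => h (gridpt n p))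
      (fun _ => h ((2*(m.1:ℝ)+1)*π/(n:ℝ), 2*(m.2:ℝ)*π/(n:ℝ))) (cell m) := by
    intro m p hp
    simp only [gridpt, idx_eq n hn _ _ hp.1, idx_eq n hn _ _ hp.2]
  have hlen : ∀ j : ℕ, volume (I j) = ENNReal.ofReal (2*π/n) := by
    intro j
    simp only [I, Real.volume_Ico]
    congr 1; field_simp; ring
  have hvol : ∀ m, volume (cell m) = ENNReal.ofReal (2*π/n) * ENNReal.ofReal (2*π/n) := by
    intro m
    rw [Measure.volume_eq_prod, Measure.prod_prod, hlen, hlen]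
  rw [hS, integral_biUnion_finset _ (fun m _ => hmeas m), ← Finset.sum_product', Finset.mul_sum]
  · refine Finset.sum_congr rfl fun m _ => ?_
    rw [setIntegral_congr_fun (hmeas m) (heq m), setIntegral_const, measureReal_def, hvol,
      ENNReal.toReal_mul, ENNReal.toReal_ofReal (by positivity), Complex.real_smul]
    push_cast; ring
  · intro a _ b _ hab
    refine Set.disjoint_left.2 fun p hpa hpb => hab ?_
    ext
    · rw [← idx_eq n hn _ _ hpa.1, ← idx_eq n hn _ _ hpb.1]
    · rw [← idx_eq n hn _ _ hpa.2, ← idx_eq n hn _ _ hpb.2]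
  · intro m _
    refine IntegrableOn.congr_fun ?_ (heq m).symm (hmeas m)
    refine integrableOn_const ?_
    rw [hvol]; exact ENNReal.mul_ne_top ENNReal.ofReal_ne_top ENNReal.ofReal_ne_top

lemma gridpt_props (n : ℕ) (hn : 0 < n) (p : ℝ × ℝ)
    (h1 : p.1 ∈ Set.Ico 0 (2*π)) (h2 : p.2 ∈ Set.Ico 0 (2*π)) :
    ‖p - gridpt n p‖ ≤ 2*π/n ∧ (gridpt n p).1 ∈ Set.Icc (π/n) (2*π - π/n) ∧
    (gridpt n p).2 ∈ Set.Icc 0 (2*π) := by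
  have hpi := Real.pi_pos
  have hn' : (0:ℝ) < n := by exact_mod_cast hn
  obtain ⟨a1, a2, a3⟩ := idx_bounds n hn _ h1
  obtain ⟨b1, b2, b3⟩ := idx_bounds n hn _ h2
  have a1' : (idx n p.1 : ℝ) + 1 ≤ n := by exact_mod_cast a1
  have b1' : (idx n p.2 : ℝ) + 1 ≤ n := by exact_mod_cast b1
  have hd : 0 < π / n := by positivity
  have key : (n:ℝ) * (π/n) = π := by field_simp
  have w1 : ∀ t : ℝ, t * π / n = t * (π/n) := fun t => by ring
  simp only [gridpt, w1] at *
  set d := π / n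
  have i1 : (0:ℝ) ≤ idx n p.1 := Nat.cast_nonneg _
  have i2 : (0:ℝ) ≤ idx n p.2 := Nat.cast_nonneg _
  refine ⟨?_, ⟨?_, ?_⟩, ?_, ?_⟩
  · rw [Prod.norm_def]
    refine max_le (abs_le.2 ?_) (abs_le.2 ?_)
    · simp only [Prod.fst_sub]; constructor <;> nlinarith
    · simp only [Prod.snd_sub]; constructor <;> nlinarith
  · nlinarith
  · nlinarith
  · positivity
  · nlinarith



/-- Convergence of Riemann sums over the shifted grid for a doubly `2π`-periodic function,
continuously differentiable away from `2πℤ²`, with a singularity of order at most one at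
the lattice points: the function is integrable on `[0,2π]²` and the Riemann sums converge
to its mean value. -/
theorem stmt13 (h : ℝ × ℝ → ℂ)
    (hper1 : ∀ θ φ : ℝ, h (θ + 2*π, φ) = h (θ, φ))
    (hper2 : ∀ θ φ : ℝ, h (θ, φ + 2*π) = h (θ, φ))
    (hdiff : ContDiffOn ℝ 1 h {p : ℝ × ℝ | ¬ ∃ a b : ℤ, p = (2*π*(a:ℝ), 2*π*(b:ℝ))})
    (C : ℝ) (hC : 0 < C)
    (hbound : ∀ p : ℝ × ℝ, p.1 ∈ Set.Ioc (-π) π → p.2 ∈ Set.Ioc (-π) π →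
      0 < ‖p‖ → ‖p‖ ≤ π →
      ‖h p‖ ≤ C / ‖p‖ ∧ ‖fderiv ℝ h p‖ ≤ C / ‖p‖^2) :
    IntegrableOn h (Set.Icc (0:ℝ) (2*π) ×ˢ Set.Icc (0:ℝ) (2*π)) ∧
    Tendsto (fun n : ℕ => (1 / (n:ℂ)^2) *
        ∑ j ∈ range n, ∑ k ∈ range n, h ((2*(j:ℝ)+1)*π/(n:ℝ), 2*(k:ℝ)*π/(n:ℝ)))
      atTop
      (nhds ((1/(4*(π:ℂ)^2)) *
        ∫ p in Set.Icc (0:ℝ) (2*π) ×ˢ Set.Icc (0:ℝ) (2*π), h p)) := by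
  have hpi := Real.pi_pos
  have hb := key_bound h hper1 hper2 C hC (fun p a b c d => (hbound p a b c d).1)
  set S := Set.Ioo (0:ℝ) (2*π) ×ˢ Set.Ioo (0:ℝ) (2*π) with hSdef
  have hSm : MeasurableSet S := measurableSet_Ioo.prod measurableSet_Ioo
  have hSo : IsOpen S := isOpen_Ioo.prod isOpen_Ioo
  have hcont : ContinuousOn h S := by
    refine hdiff.continuousOn.mono ?_
    rintro p ⟨⟨h1, h2⟩, -⟩ ⟨a, b, rfl⟩
    simp only at h1 h2
    have q1 : (0:ℝ) < a := by
      by_contra hh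
      nlinarith
    have q2 : (a:ℝ) < 1 := by
      by_contra hh
      nlinarith
    have q3 : 0 < a := by exact_mod_cast q1
    have q4 : a < 1 := by exact_mod_cast q2
    omega
  have hae : (Set.Icc (0:ℝ) (2*π) ×ˢ Set.Icc (0:ℝ) (2*π)) =ᵐ[volume] S := by
    rw [Measure.volume_eq_prod]
    exact Measure.set_prod_ae_eq Ioo_ae_eq_Icc.symm Ioo_ae_eq_Icc.symm
  have hae2 : (Set.Ico (0:ℝ) (2*π) ×ˢ Set.Ico (0:ℝ) (2*π)) =ᵐ[volume] S := by
    rw [Measure.volume_eq_prod]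
    exact Measure.set_prod_ae_eq Ioo_ae_eq_Ico.symm Ioo_ae_eq_Ico.symm
  have hdom : Integrable (fun p : ℝ × ℝ => 3 * C * (domG p.1 * domG p.2)) (volume.restrict S) :=
    Integrable.const_mul domG_integrable2 _
  constructor
  · rw [integrableOn_congr_set_ae hae]
    refine Integrable.mono' hdom (hcont.aestronglyMeasurable hSm) ?_
    refine (ae_restrict_iff' hSm).2 (Eventually.of_forall fun p hp => ?_)
    refine hb p p hp.1 hp.2 (Set.Ioo_subset_Icc_self hp.1) (Set.Ioo_subset_Icc_self hp.2) ?_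
    intro c1 c2 _ _
    have := norm_nonneg (p - (c1, c2))
    linarith
  rw [setIntegral_congr_set hae]
  have hlim : Tendsto (fun n : ℕ => ∫ p in S, h (gridpt n p)) atTop (nhds (∫ p in S, h p)) := by
    refine tendsto_integral_filter_of_dominated_convergence
      (fun p : ℝ × ℝ => 3 * C * (domG p.1 * domG p.2)) ?_ ?_ hdom ?_
    · exact Eventually.of_forall fun n => (measurable_gridpt_comp h n).aestronglyMeasurable
    · filter_upwards [eventually_gt_atTop 0] with n hn
      have hn' : (0:ℝ) < n := by exact_mod_cast hn
      have hd : 0 < π / n := by positivity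
      refine (ae_restrict_iff' hSm).2 (Eventually.of_forall fun p hp => ?_)
      obtain ⟨e1, ⟨e2, e3⟩, e4⟩ := gridpt_props n hn p (Set.Ioo_subset_Ico_self hp.1)
        (Set.Ioo_subset_Ico_self hp.2)
      refine hb p _ hp.1 hp.2 ⟨by linarith, by linarith⟩ e4 ?_
      intro c1 c2 hc1 _
      have t1 : |(gridpt n p).1 - c1| ≤ ‖gridpt n p - (c1, c2)‖ :=
        norm_fst_le (gridpt n p - (c1, c2))
      have t2 : π / n ≤ |(gridpt n p).1 - c1| := by
        rcases hc1 with rfl | rfl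
        · rw [sub_zero]; exact e2.trans (le_abs_self _)
        · rw [abs_sub_comm]; exact le_trans (by linarith) (le_abs_self _)
      have t3 : ‖p - (c1, c2)‖ ≤ ‖p - gridpt n p‖ + ‖gridpt n p - (c1, c2)‖ :=
        norm_sub_le_norm_sub_add_norm_sub _ _ _
      rw [mul_div_assoc] at e1
      linarith
    · refine (ae_restrict_iff' hSm).2 (Eventually.of_forall fun p hp => ?_)
      have hca : ContinuousAt h p := hcont.continuousAt (hSo.mem_nhds hp)
      refine hca.tendsto.comp ?_
      rw [tendsto_iff_norm_sub_tendsto_zero]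
      refine squeeze_zero' (Eventually.of_forall fun _ => norm_nonneg _) ?_
        (tendsto_const_div_atTop_nhds_zero_nat (2*π))
      filter_upwards [eventually_gt_atTop 0] with n hn
      rw [norm_sub_rev]
      exact (gridpt_props n hn p (Set.Ioo_subset_Ico_self hp.1)
        (Set.Ioo_subset_Ico_self hp.2)).1
  refine (hlim.const_mul (1/(4*(π:ℂ)^2))).congr' ?_
  filter_upwards [eventually_gt_atTop 0] with n hn
  rw [← setIntegral_congr_set hae2, integral_grid h n hn, ← mul_assoc]
  congr 1
  have : (n:ℂ) ≠ 0 := by exact_mod_cast hn.ne'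
  have hp' : (π:ℂ) ≠ 0 := by exact_mod_cast hpi.ne'
  field_simp
  ring
end
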